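/- Let Γ ⊂ P^n be a nondegenerate finite subscheme of degree d ≥ 4n² + 6n + 1 in linearly general position over an algebraically closed field of characteristic 0. If there is a rational normal curve C of degree n in P^n such that ((2n+2)/(2n+3))·(d−1) + 2n + 1 ≤ |Γ ∩ C|, then reg(Γ ∩ C) = reg(Γ). -/

import Mathlib

open MvPolynomial Filter
open scoped Classical

attribute [local instance] MvPolynomial.gradedAlgebra

noncomputable section

variable {K : Type} [Field K] {n : ℕ}

/-- The Hilbert function, in degree `m`, of the quotient of the homogeneous
coordinate ring of `ℙ^n_K` by the ideal `I`. -/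
def hilbF (I : Ideal (MvPolynomial (Fin (n+1)) K)) (m : ℕ) : ℕ :=
  Module.finrank K
    ((MvPolynomial.homogeneousSubmodule (Fin (n+1)) K m).map
      (Ideal.Quotient.mkₐ K I).toLinearMap)

/-- The irrelevant maximal ideal `(x_0, …, x_n)`. -/
def irrelevantIdeal (K : Type) [Field K] (n : ℕ) : Ideal (MvPolynomial (Fin (n+1)) K) :=
  Ideal.span (Set.range MvPolynomial.X)

/-- Saturation of a homogeneous ideal with respect to the irrelevant ideal. -/
def saturate (I : Ideal (MvPolynomial (Fin (n+1)) K)) : Ideal (MvPolynomial (Fin (n+1)) K) :=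
  ⨆ k : ℕ, Submodule.colon I ((irrelevantIdeal K n ^ k : Ideal (MvPolynomial (Fin (n+1)) K)) : Submodule (MvPolynomial (Fin (n+1)) K) (MvPolynomial (Fin (n+1)) K))

/-- `I` is the (saturated, homogeneous) ideal of a nonempty finite closed subscheme of
`ℙ^n`, i.e. its Hilbert function is eventually a positive constant. -/
structure IsFiniteSubscheme (I : Ideal (MvPolynomial (Fin (n+1)) K)) : Prop where
  homog : Ideal.IsHomogeneous (MvPolynomial.homogeneousSubmodule (Fin (n+1)) K) I
  saturated : saturate I = I
  finite : ∃ d : ℕ, 0 < d ∧ ∀ᶠ m : ℕ in atTop, hilbF I m = d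

/-- The degree (length) of the finite scheme with ideal `I` : the eventual value of
its Hilbert function. -/
def schemeDeg (I : Ideal (MvPolynomial (Fin (n+1)) K)) : ℕ :=
  if h : ∃ d : ℕ, ∀ᶠ m : ℕ in atTop, hilbF I m = d then h.choose else 0

/-- The Castelnuovo–Mumford regularity of the finite scheme with ideal `I` : the least
`p ≥ 1` such that the scheme is `(p-1)`-normal (for a finite scheme, `p`-regularity is
equivalent to `(p-1)`-normality). -/
def schemeReg (I : Ideal (MvPolynomial (Fin (n+1)) K)) : ℕ :=
  sInf {p : ℕ | 1 ≤ p ∧ ∀ m : ℕ, p - 1 ≤ m → hilbF I m = schemeDeg I}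

/-- `h¹(ℙ^n, I_Γ(q))` for a finite scheme `Γ` and `q ≥ 0`: the failure of `q`-normality,
`deg Γ - h_Γ(q)`. -/
def h1F (I : Ideal (MvPolynomial (Fin (n+1)) K)) (q : ℕ) : ℕ :=
  schemeDeg I - hilbF I q

/-- `J` is the ideal of a `t`-dimensional linear subspace of `ℙ^n`: it is generated by a
space of linear forms of codimension... i.e. of `K`-dimension `n - t`. -/
def IsLinearSubspace (J : Ideal (MvPolynomial (Fin (n+1)) K)) (t : ℕ) : Prop :=
  ∃ W : Submodule K (MvPolynomial (Fin (n+1)) K),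
    W ≤ MvPolynomial.homogeneousSubmodule (Fin (n+1)) K 1 ∧
    Module.finrank K W + t = n ∧
    J = Ideal.span (W : Set (MvPolynomial (Fin (n+1)) K))

/-- The ideal of the scheme-theoretic intersection (defined by the sum of the ideal
sheaves): the saturation of `I + J`. -/
def interIdeal (I J : Ideal (MvPolynomial (Fin (n+1)) K)) : Ideal (MvPolynomial (Fin (n+1)) K) :=
  saturate (I ⊔ J)

/-- The residual scheme `Γ : V`, where `V` is the hypersurface `{f = 0}`, is defined by
the colon ideal `(I_Γ : f)`. -/
def residualIdeal (I : Ideal (MvPolynomial (Fin (n+1)) K)) (f : MvPolynomial (Fin (n+1)) K) :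
    Ideal (MvPolynomial (Fin (n+1)) K) :=
  Submodule.colon I (Ideal.span {f})

/-- `Γ` admits a `(t+2)`-secant `t`-plane. -/
def HasSecantPlane (I : Ideal (MvPolynomial (Fin (n+1)) K)) (t : ℕ) : Prop :=
  ∃ J : Ideal (MvPolynomial (Fin (n+1)) K),
    IsLinearSubspace J t ∧ t + 2 ≤ schemeDeg (interIdeal I J)

/-- `t(Γ)`: the smallest `t` such that `Γ` admits a `(t+2)`-secant `t`-plane. -/
def tInv (I : Ideal (MvPolynomial (Fin (n+1)) K)) : ℕ :=
  sInf {t : ℕ | HasSecantPlane I t}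

/-- `Γ` is in linearly general position if `t(Γ) = n`. -/
def InLinGenPos (I : Ideal (MvPolynomial (Fin (n+1)) K)) : Prop :=
  tInv I = n

/-- `Γ ⊆ ℙ^n` is nondegenerate: `I(Γ)` contains no nonzero linear form. -/
def NondegenerateScheme (I : Ideal (MvPolynomial (Fin (n+1)) K)) : Prop :=
  Submodule.restrictScalars K I ⊓ MvPolynomial.homogeneousSubmodule (Fin (n+1)) K 1 = ⊥

/-- The (projective) dimension of the linear span `⟨Γ⟩` of the scheme with ideal `I`:
`n` minus the number of independent linear forms in `I`. -/
def spanDim (I : Ideal (MvPolynomial (Fin (n+1)) K)) : ℕ :=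
  n - Module.finrank K
    ↥(Submodule.restrictScalars K I ⊓ MvPolynomial.homogeneousSubmodule (Fin (n+1)) K 1)

/-- `Γ ∩ Λ` is nondegenerate as a subscheme of the `t`-plane `Λ`: it is contained in no
`(t-1)`-dimensional linear subspace of `Λ`. -/
def NondegenerateIn (I Λ : Ideal (MvPolynomial (Fin (n+1)) K)) (t : ℕ) : Prop :=
  ∀ J : Ideal (MvPolynomial (Fin (n+1)) K),
    IsLinearSubspace J (t - 1) → Λ ≤ J → ¬ J ≤ interIdeal I Λ

/-- `Γ ∩ Λ` is in linearly general position as a subscheme of the `t`-plane `Λ`: it has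
no `(s+2)`-secant `s`-plane inside `Λ` for any `s < t`. -/
def InLinGenPosIn (I Λ : Ideal (MvPolynomial (Fin (n+1)) K)) (t : ℕ) : Prop :=
  ∀ s : ℕ, s < t → ∀ J : Ideal (MvPolynomial (Fin (n+1)) K),
    IsLinearSubspace J s → Λ ≤ J → schemeDeg (interIdeal I J) ≤ s + 1

/-- `J` is the (saturated) homogeneous ideal of a rational normal curve of degree `t`
in `ℙ^n` : the curve is the image of `ℙ^1` under a parametrization by a basis-spanning
family of binary forms of degree `t`, and `J` is the vanishing ideal of (the affine cone
over) this image. -/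
def IsRNC (t : ℕ) (J : Ideal (MvPolynomial (Fin (n+1)) K)) : Prop :=
  ∃ p : Fin (n+1) → MvPolynomial (Fin 2) K,
    (∀ i, (p i).IsHomogeneous t) ∧
    Submodule.span K (Set.range p) = MvPolynomial.homogeneousSubmodule (Fin 2) K t ∧
    J = ⨅ x : Fin 2 → K,
      RingHom.ker (MvPolynomial.eval (fun i => MvPolynomial.eval x (p i)) :
        MvPolynomial (Fin (n+1)) K →+* K)

/-- `ρ(Γ)`: the maximal length of the intersection of `Γ` with a rational normal curve
(of degree `n`) in `ℙ^n`. -/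
def rhoInv (I : Ideal (MvPolynomial (Fin (n+1)) K)) : ℕ :=
  sSup {e : ℕ | ∃ J : Ideal (MvPolynomial (Fin (n+1)) K),
    IsRNC n J ∧ e = schemeDeg (interIdeal I J)}

/-- The (saturated homogeneous) vanishing ideal of a point of `ℙ^n`. -/
def pointIdeal (P : Projectivization K (Fin (n+1) → K)) : Ideal (MvPolynomial (Fin (n+1)) K) :=
  ⨅ c : K, RingHom.ker
    (MvPolynomial.eval (c • P.rep) : MvPolynomial (Fin (n+1)) K →+* K)

/-- The vanishing ideal of a finite set of points of `ℙ^n`. -/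
def idealOfFinset (S : Finset (Projectivization K (Fin (n+1) → K))) :
    Ideal (MvPolynomial (Fin (n+1)) K) :=
  ⨅ P ∈ S, pointIdeal P

/-- A finite set of points of `ℙ^n` is in uniform position if every subset `Y` has
Hilbert function `h_Y(ℓ) = min {|Y|, h_Γ(ℓ)}`. -/
def UniformPosition (S : Finset (Projectivization K (Fin (n+1) → K))) : Prop :=
  ∀ Y ⊆ S, ∀ ℓ : ℕ, hilbF (idealOfFinset Y) ℓ = min Y.card (hilbF (idealOfFinset S) ℓ)

end

namespace FiniteSchemeRegularity

variable {K : Type} [Field K] {n : ℕ}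

lemma finrank_map_add_finrank_inf_ker {V W : Type*} [AddCommGroup V] [Module K V]
    [AddCommGroup W] [Module K W] (f : V →ₗ[K] W) (p : Submodule K V) [FiniteDimensional K p] :
    Module.finrank K (p.map f) + Module.finrank K ↥(p ⊓ LinearMap.ker f) = Module.finrank K p := by
  rw [← (f.domRestrict p).finrank_range_add_finrank_ker, LinearMap.range_domRestrict,
    LinearMap.ker_domRestrict, ← Submodule.finrank_map_subtype_eq, Submodule.map_comap_subtype]

instance finiteDimensional_homogeneousSubmodule (m : ℕ) :
    FiniteDimensional K (homogeneousSubmodule (Fin (n+1)) K m) :=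
  Module.Finite.iff_fg.mpr (homogeneousSubmodule_fg _ _ m)

instance finiteDimensional_homogeneousSubmodule_inf (m : ℕ)
    (p : Submodule K (MvPolynomial (Fin (n+1)) K)) :
    FiniteDimensional K ↥(homogeneousSubmodule (Fin (n+1)) K m ⊓ p) :=
  Submodule.finiteDimensional_of_le inf_le_left

lemma ker_mkₐ (J : Ideal (MvPolynomial (Fin (n+1)) K)) :
    LinearMap.ker (Ideal.Quotient.mkₐ K J).toLinearMap = J.restrictScalars K := by
  ext x
  simp [Ideal.Quotient.eq_zero_iff_mem]

lemma hilbF_add_finrank (J : Ideal (MvPolynomial (Fin (n+1)) K)) (m : ℕ) :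
    hilbF J m + Module.finrank K ↥(homogeneousSubmodule (Fin (n+1)) K m ⊓ J.restrictScalars K) =
      Module.finrank K (homogeneousSubmodule (Fin (n+1)) K m) := by
  rw [← ker_mkₐ]
  exact finrank_map_add_finrank_inf_ker _ _

lemma hilbF_anti {J J' : Ideal (MvPolynomial (Fin (n+1)) K)} {m : ℕ}
    (h : homogeneousSubmodule (Fin (n+1)) K m ⊓ J.restrictScalars K ≤ J'.restrictScalars K) :
    hilbF J' m ≤ hilbF J m := by
  have h1 := hilbF_add_finrank J m
  have h2 := hilbF_add_finrank J' m
  have h3 := Submodule.finrank_mono (le_inf (inf_le_left : homogeneousSubmodule (Fin (n+1)) K m ⊓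
    J.restrictScalars K ≤ homogeneousSubmodule (Fin (n+1)) K m) h)
  omega

lemma exists_linear_nonZeroDivisor [Infinite K] (J : Ideal (MvPolynomial (Fin (n+1)) K))
    (hJ : ∀ F, (∀ i, X i * F ∈ J) → F ∈ J) :
    ∃ l ∈ homogeneousSubmodule (Fin (n+1)) K 1, ∀ F, l * F ∈ J → F ∈ J := by
  let L := homogeneousSubmodule (Fin (n+1)) K 1
  have hfin := associatedPrimes.finite (MvPolynomial (Fin (n+1)) K) (MvPolynomial (Fin (n+1)) K ⧸ J)
  let s : Finset (Subspace K L) :=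
    hfin.toFinset.image fun P => (P.restrictScalars K).comap L.subtype
  have hs : ⊤ ∉ s := by
    intro h
    obtain ⟨P, hP, hPt⟩ := Finset.mem_image.mp h
    rw [Set.Finite.mem_toFinset, AssociatedPrimes.mem_iff, isAssociatedPrime_iff] at hP
    obtain ⟨hPp, x, hx⟩ := hP
    obtain ⟨F, rfl⟩ := Ideal.Quotient.mk_surjective x
    have hX : ∀ i, (X i : MvPolynomial (Fin (n+1)) K) ∈ P := fun i => by
      have : (⟨X i, isHomogeneous_X K i⟩ : L) ∈ (P.restrictScalars K).comap L.subtype := by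
        rw [hPt]; trivial
      exact this
    have hF : F ∈ J := hJ F fun i => by
      have := hX i
      rw [hx, Submodule.mem_colon_singleton, Submodule.mem_bot] at this
      exact Ideal.Quotient.eq_zero_iff_mem.mp this
    apply hPp.ne_top
    rw [hx, Ideal.Quotient.eq_zero_iff_mem.mpr hF]
    ext y
    simp [Submodule.mem_colon_singleton]
  obtain ⟨l, hl⟩ := (Set.ne_univ_iff_exists_notMem _).mp
    (Subspace.biUnion_ne_univ_of_top_notMem hs)
  refine ⟨l, l.2, fun F hF => ?_⟩
  by_contra hFJ
  have hz : (l : MvPolynomial (Fin (n+1)) K) ∈ {r : MvPolynomial (Fin (n+1)) K |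
      ∃ x : MvPolynomial (Fin (n+1)) K ⧸ J, x ≠ 0 ∧ r • x = 0} :=
    ⟨Ideal.Quotient.mk J F, by rwa [Ne, Ideal.Quotient.eq_zero_iff_mem],
      Ideal.Quotient.eq_zero_iff_mem.mpr hF⟩
  rw [← biUnion_associatedPrimes_eq_zero_divisors] at hz
  obtain ⟨P, hP, hlP⟩ := Set.mem_iUnion₂.mp hz
  exact hl (Set.mem_iUnion₂.mpr ⟨_, Finset.mem_image.mpr ⟨P, hfin.mem_toFinset.mpr hP, rfl⟩, hlP⟩)

lemma mkₐ_mulLeft (J : Ideal (MvPolynomial (Fin (n+1)) K)) (l : MvPolynomial (Fin (n+1)) K)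
    (V : Submodule K (MvPolynomial (Fin (n+1)) K)) :
    (V.map (LinearMap.mulLeft K l)).map (Ideal.Quotient.mkₐ K J).toLinearMap =
      (V.map (Ideal.Quotient.mkₐ K J).toLinearMap).map
        (LinearMap.mulLeft K (Ideal.Quotient.mkₐ K J l)) := by
  rw [← Submodule.map_comp, ← Submodule.map_comp]
  congr 1

lemma mulLeft_mkₐ_injective {J : Ideal (MvPolynomial (Fin (n+1)) K)}
    {l : MvPolynomial (Fin (n+1)) K} (hl : ∀ F, l * F ∈ J → F ∈ J) :
    Function.Injective (LinearMap.mulLeft K (Ideal.Quotient.mkₐ K J l)) := by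
  rw [injective_iff_map_eq_zero]
  intro x hx
  obtain ⟨F, rfl⟩ := Ideal.Quotient.mkₐ_surjective K J x
  rw [LinearMap.mulLeft_apply, ← map_mul, Ideal.Quotient.mkₐ_eq_mk,
    Ideal.Quotient.eq_zero_iff_mem] at hx
  exact Ideal.Quotient.eq_zero_iff_mem.mpr (hl F hx)

lemma map_mulLeft_homogeneousSubmodule_le {l : MvPolynomial (Fin (n+1)) K}
    (hl : l ∈ homogeneousSubmodule (Fin (n+1)) K 1) (m : ℕ) :
    (homogeneousSubmodule (Fin (n+1)) K m).map (LinearMap.mulLeft K l) ≤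
      homogeneousSubmodule (Fin (n+1)) K (m+1) := by
  rintro _ ⟨F, hF, rfl⟩
  have h := IsHomogeneous.mul hl hF
  rwa [add_comm 1 m] at h

/-- Saturated ideals have nondecreasing Hilbert function. -/
lemma hilbF_monotone [Infinite K] {J : Ideal (MvPolynomial (Fin (n+1)) K)}
    (hJ : ∀ F, (∀ i, X i * F ∈ J) → F ∈ J) : Monotone (hilbF J) := by
  obtain ⟨l, hl1, hl⟩ := exists_linear_nonZeroDivisor J hJ
  refine monotone_nat_of_le_succ fun m => ?_
  rw [hilbF, (Submodule.equivMapOfInjective _ (mulLeft_mkₐ_injective hl) _).finrank_eq,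
    ← mkₐ_mulLeft]
  exact Submodule.finrank_mono (Submodule.map_mono (map_mulLeft_homogeneousSubmodule_le hl1 m))

lemma irrelevantIdeal_eq_idealOfVars : irrelevantIdeal K n = idealOfVars (Fin (n+1)) K := rfl

lemma monotone_colon_irrelevantIdeal_pow (J : Ideal (MvPolynomial (Fin (n+1)) K)) :
    Monotone fun k : ℕ => Submodule.colon J ((irrelevantIdeal K n ^ k :
      Ideal (MvPolynomial (Fin (n+1)) K)) :
      Submodule (MvPolynomial (Fin (n+1)) K) (MvPolynomial (Fin (n+1)) K)) := by
  intro a b hab F hF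
  rw [Submodule.mem_colon] at hF ⊢
  exact fun s hs => hF s (Ideal.pow_le_pow_right hab hs)

lemma mem_saturate_of_forall_mul_mem {J : Ideal (MvPolynomial (Fin (n+1)) K)} {k : ℕ}
    {F : MvPolynomial (Fin (n+1)) K} (h : ∀ s ∈ irrelevantIdeal K n ^ k, F * s ∈ J) :
    F ∈ saturate J :=
  Submodule.mem_iSup_of_mem k (Submodule.mem_colon.mpr h)

lemma le_saturate (J : Ideal (MvPolynomial (Fin (n+1)) K)) : J ≤ saturate J := fun _ hF =>
  mem_saturate_of_forall_mul_mem (k := 0) fun s _ => J.mul_mem_right s hF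

lemma exists_pow_mul_mem_of_mem_saturate (J : Ideal (MvPolynomial (Fin (n+1)) K)) :
    ∃ k : ℕ, ∀ F ∈ saturate J, ∀ s ∈ irrelevantIdeal K n ^ k, F * s ∈ J := by
  obtain ⟨k, hk⟩ := monotone_stabilizes_iff_noetherian.mpr inferInstance
    ⟨_, monotone_colon_irrelevantIdeal_pow J⟩
  refine ⟨k, fun F hF => ?_⟩
  obtain ⟨j, hj⟩ := (Submodule.mem_iSup_of_directed _
    (monotone_colon_irrelevantIdeal_pow J).directed_le).mp hF
  have h := monotone_colon_irrelevantIdeal_pow J (le_max_left j k) hj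
  have h' := hk (max j k) (le_max_right j k)
  exact Submodule.mem_colon.mp (h'.ge h)

lemma mem_saturate_of_forall_X_mul_mem (J : Ideal (MvPolynomial (Fin (n+1)) K))
    (F : MvPolynomial (Fin (n+1)) K) (hF : ∀ i, X i * F ∈ saturate J) : F ∈ saturate J := by
  obtain ⟨k, hk⟩ := exists_pow_mul_mem_of_mem_saturate J
  have hle : irrelevantIdeal K n ≤ Submodule.colon (saturate J) {F} := by
    rw [irrelevantIdeal, Ideal.span_le]
    rintro _ ⟨i, rfl⟩
    exact Submodule.mem_colon_singleton.mpr (hF i)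
  refine mem_saturate_of_forall_mul_mem (k := k + 1) fun s hs => ?_
  rw [pow_succ'] at hs
  refine Submodule.mul_induction_on hs (fun a ha b hb => ?_) fun a b ha hb => ?_
  · have := hk _ (Submodule.mem_colon_singleton.mp (hle ha)) b hb
    rwa [smul_eq_mul, mul_comm a F, mul_assoc] at this
  · rw [mul_add]
    exact J.add_mem ha hb

/-- A homogeneous ideal agrees with its saturation in all large degrees. -/
lemma exists_forall_homogeneousSubmodule_inf_saturate_le {J : Ideal (MvPolynomial (Fin (n+1)) K)}
    (hJ : J.IsHomogeneous (homogeneousSubmodule (Fin (n+1)) K)) :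
    ∃ N : ℕ, ∀ M ≥ N, homogeneousSubmodule (Fin (n+1)) K M ⊓ (saturate J).restrictScalars K ≤
      J.restrictScalars K := by
  obtain ⟨k, hk⟩ := exists_pow_mul_mem_of_mem_saturate J
  obtain ⟨G, hG⟩ := (isNoetherianRing_iff_ideal_fg _).mp
    (inferInstance : IsNoetherianRing (MvPolynomial (Fin (n+1)) K)) (saturate J)
  refine ⟨k + G.sup totalDegree + 1, fun M hM F hF => ?_⟩
  obtain ⟨hFM, hFJ⟩ := hF
  rw [Submodule.coe_restrictScalars, SetLike.mem_coe, ← hG] at hFJ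
  obtain ⟨f, -, hf⟩ := Submodule.mem_span_finset.mp hFJ
  let low : MvPolynomial (Fin (n+1)) K → MvPolynomial (Fin (n+1)) K :=
    fun a => ∑ i ∈ Finset.range k, homogeneousComponent i a
  have hlow : ∀ a, a - low a ∈ irrelevantIdeal K n ^ k := fun a => by
    rw [irrelevantIdeal_eq_idealOfVars, mem_pow_idealOfVars_iff']
    intro d hd
    simp [low, coeff_sum, coeff_homogeneousComponent, hd]
  have hdeg : ∀ a, (low a).totalDegree ≤ k := fun a =>
    (totalDegree_finsetSum _ _).trans <| Finset.sup_le fun i hi =>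
      (homogeneousComponent_isHomogeneous i a).totalDegree_le.trans (Finset.mem_range.mp hi).le
  have hE : F - ∑ g ∈ G, low (f g) * g ∈ J := by
    rw [← hf, ← Finset.sum_sub_distrib]
    refine J.sum_mem fun g hg => ?_
    rw [smul_eq_mul, ← sub_mul, mul_comm]
    exact hk g (hG ▸ Ideal.subset_span hg) _ (hlow _)
  have h := homogeneousComponent_mem_of_mem hJ hE M
  rw [map_sub, homogeneousComponent_eq_self hFM, homogeneousComponent_eq_zero, sub_zero] at h
  · exact h
  · refine lt_of_le_of_lt ((totalDegree_finsetSum _ _).trans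
      (Finset.sup_le (a := k + G.sup totalDegree) fun g hg => ?_)) hM
    exact (totalDegree_mul _ _).trans (add_le_add (hdeg _) (Finset.le_sup hg))

lemma schemeDeg_eq_of_eventually {J : Ideal (MvPolynomial (Fin (n+1)) K)} {d : ℕ}
    (h : ∀ᶠ m : ℕ in atTop, hilbF J m = d) : schemeDeg J = d := by
  have hex : ∃ d : ℕ, ∀ᶠ m : ℕ in atTop, hilbF J m = d := ⟨d, h⟩
  rw [schemeDeg, dif_pos hex]
  obtain ⟨m, h1, h2⟩ := (hex.choose_spec.and h).exists
  exact h1.symm.trans h2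

lemma eventually_hilbF_eq_schemeDeg {J : Ideal (MvPolynomial (Fin (n+1)) K)}
    (h : schemeDeg J ≠ 0) : ∀ᶠ m : ℕ in atTop, hilbF J m = schemeDeg J := by
  by_cases hex : ∃ d : ℕ, ∀ᶠ m : ℕ in atTop, hilbF J m = d
  · obtain ⟨d, hd⟩ := hex
    rwa [schemeDeg_eq_of_eventually hd]
  · exact absurd (dif_neg hex) h

lemma exists_eventually_eq_of_monotone {g : ℕ → ℕ} (hg : Monotone g) {d : ℕ}
    (hd : ∀ m, g m ≤ d) : ∃ c, ∀ᶠ m in atTop, g m = c := by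
  have hbdd : BddAbove (Set.range g) := ⟨d, Set.forall_mem_range.mpr hd⟩
  obtain ⟨N, hN⟩ := Nat.sSup_mem (Set.range_nonempty g) hbdd
  refine ⟨g N, eventually_atTop.mpr ⟨N, fun m hm => le_antisymm ?_ (hg hm)⟩⟩
  rw [hN]
  exact le_csSup hbdd ⟨m, rfl⟩

lemma min_le_of_strict_growth {g : ℕ → ℕ} (hg : Monotone g)
    (hstep : ∀ m, 1 ≤ m → g (m + 1) = g m → g (m + 2) = g (m + 1)) {c : ℕ}
    (hc : ∀ᶠ m in atTop, g m = c) (m : ℕ) : min c m ≤ g (m + 1) := by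
  induction m with
  | zero => simp
  | succ m ih =>
    by_cases h : g (m + 2) = g (m + 1)
    · have hconst : ∀ j, g (m + 1 + j + 1) = g (m + 1 + j) := fun j => by
        induction j with
        | zero => exact h
        | succ j ihj => exact hstep (m + 1 + j) (by omega) ihj
      have hall : ∀ j, g (m + 1 + j) = g (m + 1) := fun j => by
        induction j with
        | zero => rfl
        | succ j ihj => exact (hconst j).trans ihj
      obtain ⟨N, hN⟩ := eventually_atTop.mp hc
      have h1 := hN (m + 1 + N) (by omega)
      rw [hall] at h1
      show min c (m + 1) ≤ g (m + 2)
      omega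
    · have := hg (show m + 1 ≤ m + 2 by omega)
      show min c (m + 1) ≤ g (m + 2)
      omega

/-- The degree `m` part of `(I + C) / I`. -/
noncomputable def residualPart (I C : Ideal (MvPolynomial (Fin (n+1)) K)) (m : ℕ) :
    Submodule K (MvPolynomial (Fin (n+1)) K ⧸ I) :=
  (homogeneousSubmodule (Fin (n+1)) K m ⊓ C.restrictScalars K).map
    (Ideal.Quotient.mkₐ K I).toLinearMap

instance (I C : Ideal (MvPolynomial (Fin (n+1)) K)) (m : ℕ) :
    FiniteDimensional K (residualPart I C m) :=
  inferInstanceAs (FiniteDimensional K ↥(Submodule.map (Ideal.Quotient.mkₐ K I).toLinearMap _))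

lemma hilbF_eq_finrank_residualPart_add {I C : Ideal (MvPolynomial (Fin (n+1)) K)}
    (hI : I.IsHomogeneous (homogeneousSubmodule (Fin (n+1)) K))
    (hC : C.IsHomogeneous (homogeneousSubmodule (Fin (n+1)) K)) (m : ℕ) :
    hilbF I m = Module.finrank K (residualPart I C m) + hilbF (I ⊔ C) m := by
  have h1 := hilbF_add_finrank I m
  have h2 := hilbF_add_finrank (I ⊔ C) m
  have hmap : residualPart I C m = (homogeneousSubmodule (Fin (n+1)) K m ⊓
      (I ⊔ C).restrictScalars K).map (Ideal.Quotient.mkₐ K I).toLinearMap := by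
    refine le_antisymm (Submodule.map_mono (inf_le_inf_left _ ?_)) ?_
    · exact fun F hF => (le_sup_right : C ≤ I ⊔ C) hF
    · rintro _ ⟨F, ⟨hFm, hF⟩, rfl⟩
      obtain ⟨a, ha, b, hb, rfl⟩ := Submodule.mem_sup.mp hF
      refine ⟨homogeneousComponent m b, ⟨homogeneousComponent_mem m b,
        homogeneousComponent_mem_of_mem hC hb m⟩, ?_⟩
      have h := homogeneousComponent_eq_self hFm
      rw [map_add] at h
      refine (Ideal.Quotient.eq.mpr ?_).symm
      rw [← h, add_sub_cancel_right]
      exact homogeneousComponent_mem_of_mem hI ha m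
  have h3 := finrank_map_add_finrank_inf_ker (Ideal.Quotient.mkₐ K I).toLinearMap
    (homogeneousSubmodule (Fin (n+1)) K m ⊓ (I ⊔ C).restrictScalars K)
  have hle : I.restrictScalars K ≤ (I ⊔ C).restrictScalars K :=
    fun F hF => (le_sup_left : I ≤ I ⊔ C) hF
  rw [ker_mkₐ, inf_assoc, inf_eq_right.mpr hle, ← hmap] at h3
  omega

lemma map_mulLeft_residualPart_le {I C : Ideal (MvPolynomial (Fin (n+1)) K)}
    {l : MvPolynomial (Fin (n+1)) K} (hl : l ∈ homogeneousSubmodule (Fin (n+1)) K 1) (m : ℕ) :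
    (residualPart I C m).map (LinearMap.mulLeft K (Ideal.Quotient.mkₐ K I l)) ≤
      residualPart I C (m + 1) := by
  rw [residualPart, ← mkₐ_mulLeft]
  refine Submodule.map_mono (le_inf ((Submodule.map_mono inf_le_left).trans
    (map_mulLeft_homogeneousSubmodule_le hl m)) ?_)
  rintro _ ⟨F, hF, rfl⟩
  exact C.mul_mem_left l hF.2

lemma residualPart_succ_le_of_le {I C : Ideal (MvPolynomial (Fin (n+1)) K)}
    {l : MvPolynomial (Fin (n+1)) K} {m : ℕ}
    (hgen : homogeneousSubmodule (Fin (n+1)) K (m + 2) ⊓ C.restrictScalars K ≤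
      homogeneousSubmodule (Fin (n+1)) K 1 *
        (homogeneousSubmodule (Fin (n+1)) K (m + 1) ⊓ C.restrictScalars K))
    (h : residualPart I C (m + 1) ≤
      (residualPart I C m).map (LinearMap.mulLeft K (Ideal.Quotient.mkₐ K I l))) :
    residualPart I C (m + 2) ≤
      (residualPart I C (m + 1)).map (LinearMap.mulLeft K (Ideal.Quotient.mkₐ K I l)) := by
  refine (Submodule.map_mono hgen).trans ?_
  rw [Submodule.map_le_iff_le_comap, Submodule.mul_le]
  intro x hx F hF
  obtain ⟨_, ⟨G, hG, rfl⟩, hGF⟩ := h ⟨F, hF, rfl⟩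
  refine ⟨Ideal.Quotient.mkₐ K I x * Ideal.Quotient.mkₐ K I G,
    map_mulLeft_residualPart_le hx m ⟨_, ⟨G, hG, rfl⟩, rfl⟩, ?_⟩
  have hGF' : Ideal.Quotient.mkₐ K I l * Ideal.Quotient.mkₐ K I G =
    Ideal.Quotient.mkₐ K I F := hGF
  show Ideal.Quotient.mkₐ K I l * (Ideal.Quotient.mkₐ K I x * Ideal.Quotient.mkₐ K I G) =
    Ideal.Quotient.mkₐ K I (x * F)
  rw [map_mul, ← hGF']
  ring

lemma hilbF_succ_le_of_eq [Infinite K] {I J : Ideal (MvPolynomial (Fin (n+1)) K)} (hIJ : I ≤ J)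
    (hI : ∀ F, (∀ i, X i * F ∈ I) → F ∈ I) {m : ℕ} (h : hilbF I (m + 1) = hilbF I m) :
    hilbF J (m + 1) ≤ hilbF J m := by
  obtain ⟨l, hl1, hl⟩ := exists_linear_nonZeroDivisor I hI
  have heq : (homogeneousSubmodule (Fin (n+1)) K (m+1)).map (Ideal.Quotient.mkₐ K I).toLinearMap ≤
      ((homogeneousSubmodule (Fin (n+1)) K m).map (LinearMap.mulLeft K l)).map
        (Ideal.Quotient.mkₐ K I).toLinearMap := by
    refine (Submodule.eq_of_le_of_finrank_eq
      (Submodule.map_mono (map_mulLeft_homogeneousSubmodule_le hl1 m)) ?_).ge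
    rw [mkₐ_mulLeft, ← (Submodule.equivMapOfInjective _ (mulLeft_mkₐ_injective hl) _).finrank_eq]
    exact h.symm
  have hle : (homogeneousSubmodule (Fin (n+1)) K (m+1)).map (Ideal.Quotient.mkₐ K J).toLinearMap ≤
      ((homogeneousSubmodule (Fin (n+1)) K m).map (Ideal.Quotient.mkₐ K J).toLinearMap).map
        (LinearMap.mulLeft K (Ideal.Quotient.mkₐ K J l)) := by
    rw [← mkₐ_mulLeft]
    rintro _ ⟨F, hF, rfl⟩
    obtain ⟨G, hG, hGF⟩ := heq ⟨F, hF, rfl⟩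
    exact ⟨G, hG, Ideal.Quotient.eq.mpr (hIJ (Ideal.Quotient.eq.mp hGF))⟩
  exact (Submodule.finrank_mono hle).trans (Submodule.finrank_map_le _ _)

/-- Let `C` be a homogeneous ideal generated in degrees at most two, of Hilbert function bounded
by `n m + 1`. If `e = deg (Γ ∩ C)` is close enough to `d = deg Γ`, then `Γ` and `Γ ∩ C` are
`m`-normal for the same `m`. -/
theorem hilbF_interIdeal_eq_schemeDeg_iff [Infinite K] {I C : Ideal (MvPolynomial (Fin (n+1)) K)}
    (hI : IsFiniteSubscheme I)
    (hC : C.IsHomogeneous (homogeneousSubmodule (Fin (n+1)) K))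
    (hgen : ∀ m, homogeneousSubmodule (Fin (n+1)) K (m + 3) ⊓ C.restrictScalars K ≤
      homogeneousSubmodule (Fin (n+1)) K 1 *
        (homogeneousSubmodule (Fin (n+1)) K (m + 2) ⊓ C.restrictScalars K))
    (hcurve : ∀ m, hilbF C m ≤ n * m + 1)
    (hclose : ∀ m, schemeDeg (interIdeal I C) ≤ n * m + 1 →
      schemeDeg I + 1 ≤ schemeDeg (interIdeal I C) + m) (m : ℕ) :
    hilbF (interIdeal I C) m = schemeDeg (interIdeal I C) ↔ hilbF I m = schemeDeg I := by
  have hIsat : ∀ F, (∀ i, X i * F ∈ I) → F ∈ I := fun F hF => by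
    have h := mem_saturate_of_forall_X_mul_mem I F
    rw [hI.saturated] at h
    exact h hF
  have hImono := hilbF_monotone hIsat
  have hJmono : Monotone (hilbF (interIdeal I C)) :=
    hilbF_monotone (mem_saturate_of_forall_X_mul_mem _)
  have hJ0 : I ⊔ C ≤ interIdeal I C := le_saturate _
  have hIev : ∀ᶠ m in atTop, hilbF I m = schemeDeg I := by
    obtain ⟨d, -, hd⟩ := hI.finite
    rwa [schemeDeg_eq_of_eventually hd]
  have hIle : ∀ m, hilbF I m ≤ schemeDeg I := fun m => by
    obtain ⟨k, hk, hmk⟩ := (hIev.and (eventually_ge_atTop m)).exists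
    exact hk ▸ hImono hmk
  let g : ℕ → ℕ := fun m => Module.finrank K (residualPart I C m)
  have hsum : ∀ m, hilbF I m = g m + hilbF (I ⊔ C) m :=
    hilbF_eq_finrank_residualPart_add hI.homog hC
  obtain ⟨l, hl1, hl⟩ := exists_linear_nonZeroDivisor I hIsat
  have hmapeq : ∀ m, Module.finrank K ((residualPart I C m).map
      (LinearMap.mulLeft K (Ideal.Quotient.mkₐ K I l))) = g m := fun m =>
    (Submodule.equivMapOfInjective _ (mulLeft_mkₐ_injective hl) _).finrank_eq.symm
  have hgmono : Monotone g := monotone_nat_of_le_succ fun m =>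
    (hmapeq m).ge.trans (Submodule.finrank_mono (map_mulLeft_residualPart_le hl1 m))
  have hgstep : ∀ m, 1 ≤ m → g (m + 1) = g m → g (m + 2) = g (m + 1) := fun m hm h => by
    obtain ⟨j, rfl⟩ : ∃ j, m = j + 1 := ⟨m - 1, by omega⟩
    have h1 := (Submodule.eq_of_le_of_finrank_eq (map_mulLeft_residualPart_le hl1 (j + 1))
      ((hmapeq (j + 1)).trans h.symm)).ge
    have h2 := Submodule.finrank_mono (residualPart_succ_le_of_le (hgen j) h1)
    exact le_antisymm (h2.trans (hmapeq _).le) (hgmono (Nat.le_succ _))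
  obtain ⟨c, hc⟩ := exists_eventually_eq_of_monotone hgmono
    (fun m => (Nat.le_add_right _ _).trans ((hsum m).ge.trans (hIle m)))
  have hJle : ∀ m, hilbF (interIdeal I C) m ≤ hilbF (I ⊔ C) m := fun m =>
    hilbF_anti (inf_le_right.trans hJ0)
  obtain ⟨N, hN⟩ := exists_forall_homogeneousSubmodule_inf_saturate_le (hI.homog.sup hC)
  have hJev : ∀ᶠ m in atTop, hilbF (interIdeal I C) m = schemeDeg I - c := by
    filter_upwards [hIev, hc, eventually_ge_atTop N] with k h1 h2 h3
    have h4 := le_antisymm (hJle k) (hilbF_anti (hN k h3))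
    have := hsum k
    omega
  have hJdeg := schemeDeg_eq_of_eventually hJev
  have hcd : c ≤ schemeDeg I := by
    obtain ⟨k, h1, h2⟩ := (hIev.and hc).exists
    have := hsum k
    omega
  constructor
  · intro h
    have h1 : schemeDeg (interIdeal I C) ≤ n * m + 1 :=
      h ▸ (hilbF_anti (inf_le_right.trans ((le_sup_right : C ≤ I ⊔ C).trans hJ0))).trans
        (hcurve m)
    have h2 := hclose m h1
    obtain ⟨j, rfl⟩ : ∃ j, m = j + 1 := ⟨m - 1, by omega⟩
    have h3 := min_le_of_strict_growth hgmono hgstep hc j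
    have h4 := hsum (j + 1)
    have h5 := hJle (j + 1)
    have h6 := hIle (j + 1)
    omega
  · intro h
    have hIconst : ∀ k, m ≤ k → hilbF I k = schemeDeg I := fun k hk =>
      le_antisymm (hIle k) (h ▸ hImono hk)
    have hJconst : ∀ k, m ≤ k → hilbF (interIdeal I C) k ≤ hilbF (interIdeal I C) m := by
      intro k hk
      induction k, hk using Nat.le_induction with
      | base => exact le_rfl
      | succ k hk ih =>
        exact (hilbF_succ_le_of_eq (le_sup_left.trans hJ0) hIsat
          ((hIconst (k + 1) (by omega)).trans (hIconst k hk).symm)).trans ih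
    obtain ⟨k, h1, h2⟩ := (hJev.and (eventually_ge_atTop m)).exists
    rw [hJdeg]
    exact le_antisymm ((hJmono h2).trans h1.le) (h1 ▸ hJconst k h2)

section CurveParametrization

variable {C : Ideal (MvPolynomial (Fin (n+1)) K)}
  {ψ : MvPolynomial (Fin (n+1)) K →ₐ[K] Polynomial K}

lemma hilbF_le_of_parametrization
    (hC : ∀ m, ∀ F ∈ homogeneousSubmodule (Fin (n+1)) K m, F ∈ C ↔ ψ F = 0)
    (hdeg : ∀ m, ∀ F ∈ homogeneousSubmodule (Fin (n+1)) K m, (ψ F).natDegree ≤ n * m) (m : ℕ) :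
    hilbF C m ≤ n * m + 1 := by
  have h1 := hilbF_add_finrank C m
  have h2 := finrank_map_add_finrank_inf_ker ψ.toLinearMap (homogeneousSubmodule (Fin (n+1)) K m)
  have hker : homogeneousSubmodule (Fin (n+1)) K m ⊓ LinearMap.ker ψ.toLinearMap =
      homogeneousSubmodule (Fin (n+1)) K m ⊓ C.restrictScalars K := by
    ext F
    simp only [Submodule.mem_inf, LinearMap.mem_ker, AlgHom.toLinearMap_apply,
      Submodule.restrictScalars_mem]
    exact and_congr_right fun hF => (hC m F hF).symm
  have hle : (homogeneousSubmodule (Fin (n+1)) K m).map ψ.toLinearMap ≤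
      Polynomial.degreeLT K (n * m + 1) := by
    rintro _ ⟨F, hF, rfl⟩
    exact Polynomial.mem_degreeLT.mpr (Polynomial.natDegree_le_iff_degree_le.mp
      (hdeg m F hF) |>.trans_lt (by exact_mod_cast Nat.lt_succ_self _))
  have : FiniteDimensional K (Polynomial.degreeLT K (n * m + 1)) :=
    (Polynomial.degreeLTEquiv K (n * m + 1)).symm.finiteDimensional
  have h3 := Submodule.finrank_mono hle
  rw [(Polynomial.degreeLTEquiv K (n * m + 1)).finrank_eq, Module.finrank_fin_fun] at h3
  rw [hker] at h2
  omega

/-- The ideal of a curve parametrized by all polynomials of degree at most `n` is generated in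
degrees at most two. -/
lemma homogeneousSubmodule_inf_le_mul_of_parametrization
    (hC : ∀ m, ∀ F ∈ homogeneousSubmodule (Fin (n+1)) K m, F ∈ C ↔ ψ F = 0)
    (hdeg : ∀ m, ∀ F ∈ homogeneousSubmodule (Fin (n+1)) K m, (ψ F).natDegree ≤ n * m)
    (hsurj : ∀ m, ∀ f : Polynomial K, f.natDegree ≤ n * m →
      ∃ F ∈ homogeneousSubmodule (Fin (n+1)) K m, ψ F = f) (m : ℕ) :
    homogeneousSubmodule (Fin (n+1)) K (m + 3) ⊓ C.restrictScalars K ≤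
      homogeneousSubmodule (Fin (n+1)) K 1 *
        (homogeneousSubmodule (Fin (n+1)) K (m + 2) ⊓ C.restrictScalars K) := by
  have hmul : ∀ {k : ℕ} {a b : MvPolynomial (Fin (n+1)) K},
      a ∈ homogeneousSubmodule (Fin (n+1)) K 1 → b ∈ homogeneousSubmodule (Fin (n+1)) K k →
      a * b ∈ homogeneousSubmodule (Fin (n+1)) K (k + 1) := fun ha hb =>
    map_mulLeft_homogeneousSubmodule_le ha _ ⟨_, hb, rfl⟩
  obtain ⟨y, hy, hψy⟩ := hsurj 1 1 (by simp)
  obtain ⟨z, hz, hψz⟩ := hsurj 1 (Polynomial.X ^ n) (by simp)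
  have hsplit : ∀ G ∈ homogeneousSubmodule (Fin (n+1)) K (m + 2),
      ∃ P ∈ homogeneousSubmodule (Fin (n+1)) K (m + 1),
      ∃ Q ∈ homogeneousSubmodule (Fin (n+1)) K (m + 1), G - (y * P + z * Q) ∈ C := by
    intro G hG
    have hX : (Polynomial.X ^ n : Polynomial K).Monic := Polynomial.monic_X_pow n
    have hGdeg := hdeg _ G hG
    obtain ⟨P, hP, hψP⟩ := hsurj (m + 1) (ψ G %ₘ Polynomial.X ^ n) (by
      have := Polynomial.natDegree_modByMonic_le (ψ G) hX
      rw [Polynomial.natDegree_X_pow] at this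
      nlinarith)
    obtain ⟨Q, hQ, hψQ⟩ := hsurj (m + 1) (ψ G /ₘ Polynomial.X ^ n) (by
      rw [Polynomial.natDegree_divByMonic _ hX, Polynomial.natDegree_X_pow]
      have : n * (m + 2) = n * (m + 1) + n := by ring
      omega)
    refine ⟨P, hP, Q, hQ, (hC (m + 2) _ (sub_mem hG (add_mem (hmul hy hP) (hmul hz hQ)))).mpr ?_⟩
    rw [map_sub, map_add, map_mul, map_mul, hψy, hψz, hψP, hψQ, one_mul,
      Polynomial.modByMonic_add_div, sub_self]
  have hsplit' : ∀ F ∈ homogeneousSubmodule (Fin (n+1)) K (m + 3),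
      ∃ P ∈ homogeneousSubmodule (Fin (n+1)) K (m + 2),
      ∃ Q ∈ homogeneousSubmodule (Fin (n+1)) K (m + 2), F - (y * P + z * Q) ∈
        homogeneousSubmodule (Fin (n+1)) K 1 *
          (homogeneousSubmodule (Fin (n+1)) K (m + 2) ⊓ C.restrictScalars K) := by
    intro F hF
    rw [← homogeneousSubmodule_one_pow, pow_succ', homogeneousSubmodule_one_pow] at hF
    refine Submodule.mul_induction_on hF (fun x hx G hG => ?_) fun F₁ F₂ h₁ h₂ => ?_
    · obtain ⟨P, hP, Q, hQ, h⟩ := hsplit G hG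
      refine ⟨x * P, hmul hx hP, x * Q, hmul hx hQ, ?_⟩
      have heq : x * G - (y * (x * P) + z * (x * Q)) = x * (G - (y * P + z * Q)) := by ring
      rw [heq]
      exact Submodule.mul_mem_mul hx ⟨sub_mem hG (add_mem (hmul hy hP) (hmul hz hQ)), h⟩
    · obtain ⟨P₁, hP₁, Q₁, hQ₁, h₁⟩ := h₁
      obtain ⟨P₂, hP₂, Q₂, hQ₂, h₂⟩ := h₂
      refine ⟨P₁ + P₂, add_mem hP₁ hP₂, Q₁ + Q₂, add_mem hQ₁ hQ₂, ?_⟩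
      have heq : F₁ + F₂ - (y * (P₁ + P₂) + z * (Q₁ + Q₂)) =
        (F₁ - (y * P₁ + z * Q₁)) + (F₂ - (y * P₂ + z * Q₂)) := by ring
      rw [heq]
      exact add_mem h₁ h₂
  have hker : homogeneousSubmodule (Fin (n+1)) K 1 *
      (homogeneousSubmodule (Fin (n+1)) K (m + 2) ⊓ C.restrictScalars K) ≤
        LinearMap.ker ψ.toLinearMap := Submodule.mul_le.mpr fun a _ b hb => by
    rw [LinearMap.mem_ker, AlgHom.toLinearMap_apply, map_mul, (hC _ b hb.1).mp hb.2, mul_zero]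
  rintro F ⟨hFm, hF⟩
  obtain ⟨P, hP, Q, hQ, h⟩ := hsplit' F hFm
  have hPQ : ψ P = Polynomial.X ^ n * -ψ Q := by
    have h0 := LinearMap.mem_ker.mp (hker h)
    rw [AlgHom.toLinearMap_apply, map_sub, map_add, map_mul, map_mul, hψy, hψz,
      (hC _ F hFm).mp hF] at h0
    linear_combination -h0
  obtain ⟨U, hU, hψU⟩ := hsurj (m + 1) (-ψ Q) (by
    by_cases hQ0 : -ψ Q = 0
    · simp [hQ0]
    · have h1 := hdeg _ P hP
      rw [hPQ, Polynomial.natDegree_mul (pow_ne_zero _ Polynomial.X_ne_zero) hQ0,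
        Polynomial.natDegree_X_pow] at h1
      have : n * (m + 2) = n * (m + 1) + n := by ring
      omega)
  have hP' : P - z * U ∈ homogeneousSubmodule (Fin (n+1)) K (m + 2) ⊓ C.restrictScalars K := by
    have hmem := sub_mem hP (hmul hz hU)
    exact ⟨hmem, (hC _ _ hmem).mpr (by rw [map_sub, map_mul, hψz, hψU, hPQ, sub_self])⟩
  have hQ' : Q + y * U ∈ homogeneousSubmodule (Fin (n+1)) K (m + 2) ⊓ C.restrictScalars K := by
    have hmem := add_mem hQ (hmul hy hU)
    exact ⟨hmem, (hC _ _ hmem).mpr (by rw [map_add, map_mul, hψy, hψU, one_mul, add_neg_cancel])⟩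
  have heq : F = (F - (y * P + z * Q)) + (y * (P - z * U) + z * (Q + y * U)) := by ring
  rw [heq]
  exact add_mem h (add_mem (Submodule.mul_mem_mul hy hP') (Submodule.mul_mem_mul hz hQ'))

end CurveParametrization

/-- The dehomogenized parametrization `X i ↦ p i (T, 1)`. -/
noncomputable def dehomogenizedParam (p : Fin (n+1) → MvPolynomial (Fin 2) K) :
    MvPolynomial (Fin (n+1)) K →ₐ[K] Polynomial K :=
  (aeval ![Polynomial.X, 1]).comp (aeval p)

lemma aeval_X_one_eq_zero_iff {m : ℕ} {q : MvPolynomial (Fin 2) K} (hq : q.IsHomogeneous m) :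
    aeval ![(Polynomial.X : Polynomial K), 1] q = 0 ↔ q = 0 := by
  refine ⟨fun h => ?_, fun h => by rw [h, map_zero]⟩
  rw [← Polynomial.homogenize_eq_of_isHomogeneous hq h, Polynomial.homogenize_zero]

lemma natDegree_aeval_X_one_le {m : ℕ} {q : MvPolynomial (Fin 2) K} (hq : q.IsHomogeneous m) :
    (aeval ![(Polynomial.X : Polynomial K), 1] q).natDegree ≤ m := by
  have h := aeval_natDegree_le (n := 1) q hq.totalDegree_le ![(Polynomial.X : Polynomial K), 1]
    (fun i => by fin_cases i <;> simp)
  rwa [mul_one] at h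

lemma exists_dehomogenizedParam_eq {p : Fin (n+1) → MvPolynomial (Fin 2) K}
    (hspan : Submodule.span K (Set.range p) = homogeneousSubmodule (Fin 2) K n) (m : ℕ)
    (f : Polynomial K) (hf : f.natDegree ≤ n * m) :
    ∃ F ∈ homogeneousSubmodule (Fin (n+1)) K m, dehomogenizedParam p F = f := by
  have hone : ∀ g : Polynomial K, g.natDegree ≤ n →
      ∃ F ∈ homogeneousSubmodule (Fin (n+1)) K 1, dehomogenizedParam p F = g := fun g hg => by
    have h : g.homogenize n ∈ Submodule.span K (Set.range p) :=
      hspan ▸ Polynomial.isHomogeneous_homogenize g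
    obtain ⟨c, hc⟩ := (Submodule.mem_span_range_iff_exists_fun K).mp h
    refine ⟨∑ i, c i • (X i : MvPolynomial (Fin (n+1)) K), Submodule.sum_mem _ fun i _ =>
      Submodule.smul_mem _ _ (isHomogeneous_X K i), ?_⟩
    have : aeval p (∑ i, c i • (X i : MvPolynomial (Fin (n+1)) K)) = g.homogenize n := by
      rw [map_sum, ← hc]
      simp
    rw [dehomogenizedParam, AlgHom.comp_apply, this, Polynomial.aeval_homogenize_X_one g hg]
  induction m generalizing f with
  | zero =>
    rw [mul_zero, Nat.le_zero] at hf
    refine ⟨MvPolynomial.C (f.coeff 0), isHomogeneous_C _ _, ?_⟩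
    rw [← algebraMap_eq, AlgHom.commutes, Polynomial.algebraMap_eq,
      ← Polynomial.eq_C_of_natDegree_eq_zero hf]
  | succ m ih =>
    obtain rfl | hm := Nat.eq_zero_or_pos m
    · exact hone f (by simpa using hf)
    have hX : (Polynomial.X ^ n : Polynomial K).Monic := Polynomial.monic_X_pow n
    obtain ⟨P, hP, hψP⟩ := ih (f %ₘ Polynomial.X ^ n) (by
      have := Polynomial.natDegree_modByMonic_le f hX
      rw [Polynomial.natDegree_X_pow] at this
      nlinarith)
    obtain ⟨Q, hQ, hψQ⟩ := ih (f /ₘ Polynomial.X ^ n) (by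
      rw [Polynomial.natDegree_divByMonic _ hX, Polynomial.natDegree_X_pow]
      have : n * (m + 1) = n * m + n := by ring
      omega)
    obtain ⟨y, hy, hψy⟩ := hone 1 (by simp)
    obtain ⟨z, hz, hψz⟩ := hone (Polynomial.X ^ n) (by simp)
    refine ⟨y * P + z * Q, add_mem (map_mulLeft_homogeneousSubmodule_le hy _ ⟨_, hP, rfl⟩)
      (map_mulLeft_homogeneousSubmodule_le hz _ ⟨_, hQ, rfl⟩), ?_⟩
    rw [map_add, map_mul, map_mul, hψy, hψz, hψP, hψQ, one_mul, Polynomial.modByMonic_add_div]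

section ImageOfBinaryForms

variable [Infinite K] {p : Fin (n+1) → MvPolynomial (Fin 2) K}

lemma mem_iInf_ker_eval_iff (F : MvPolynomial (Fin (n+1)) K) :
    (F ∈ ⨅ x : Fin 2 → K, RingHom.ker (eval (fun i => eval x (p i)) :
      MvPolynomial (Fin (n+1)) K →+* K)) ↔ aeval p F = 0 := by
  have heval : ∀ x, eval x (aeval p F) = eval (fun i => eval x (p i)) F := fun x => by
    induction F using MvPolynomial.induction_on <;> simp_all
  simp only [Ideal.mem_iInf, RingHom.mem_ker, ← heval]
  exact ⟨fun h => MvPolynomial.funext fun x => by rw [h, map_zero], fun h x => by rw [h, map_zero]⟩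

lemma isHomogeneous_iInf_ker_eval (hn : 1 ≤ n) (hp : ∀ i, (p i).IsHomogeneous n) :
    (⨅ x : Fin 2 → K, RingHom.ker (eval (fun i => eval x (p i)) :
      MvPolynomial (Fin (n+1)) K →+* K)).IsHomogeneous (homogeneousSubmodule (Fin (n+1)) K) := by
  intro j F hF
  rw [mem_iInf_ker_eval_iff] at hF ⊢
  have hdec : (DirectSum.decompose (homogeneousSubmodule (Fin (n+1)) K) F j :
      MvPolynomial (Fin (n+1)) K) = homogeneousComponent j F :=
    decomposition.decompose'_apply F j
  rw [hdec]
  have h := congrArg (homogeneousComponent (n * j)) hF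
  rw [← sum_homogeneousComponent F, map_sum, map_sum, map_zero] at h
  have hcomp : ∀ i, homogeneousComponent (n * j) (aeval p (homogeneousComponent i F)) =
      if i = j then aeval p (homogeneousComponent j F) else 0 := fun i => by
    rw [homogeneousComponent_of_mem ((homogeneousComponent_isHomogeneous i F).aeval p hp)]
    by_cases hij : i = j
    · simp [hij]
    · rw [if_neg hij, if_neg]
      exact fun h => hij (Nat.eq_of_mul_eq_mul_left hn h).symm
  simp only [hcomp, Finset.sum_ite_eq', Finset.mem_range] at h
  by_cases hj : j < F.totalDegree + 1
  · rwa [if_pos hj] at h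
  · rw [homogeneousComponent_eq_zero j F (by omega), map_zero]

end ImageOfBinaryForms

lemma hilbF_eq_one_of_schemeDeg_ne_zero {J : Ideal (MvPolynomial (Fin (0+1)) K)}
    (h : schemeDeg J ≠ 0) (m : ℕ) : hilbF J m = 1 := by
  have hX : ∀ k, homogeneousSubmodule (Fin (0+1)) K k = Submodule.span K {X 0 ^ k} := fun k => by
    rw [← homogeneousSubmodule_one_pow, homogeneousSubmodule_one_eq_span_X, Submodule.span_pow,
      ← Set.singleton_pow]
    congr 2
    exact Set.ext fun F =>
      ⟨fun ⟨i, hi⟩ => by rw [← hi, Fin.fin_one_eq_zero i]; rfl, fun h => ⟨0, h.symm⟩⟩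
  have hmap : ∀ k, hilbF J k = Module.finrank K
      ↥(Submodule.span K {Ideal.Quotient.mkₐ K J (X 0 ^ k)}) := fun k => by
    rw [hilbF, hX, Submodule.map_span, Set.image_singleton, AlgHom.toLinearMap_apply]
  rw [hmap]
  refine finrank_span_singleton fun h0 => ?_
  obtain ⟨k, hk, hmk⟩ := ((eventually_hilbF_eq_schemeDeg h).and (eventually_ge_atTop m)).exists
  rw [← hk, hmap, ← Nat.sub_add_cancel hmk, pow_add, map_mul, h0, mul_zero] at h
  simp at h

lemma schemeDeg_add_one_le {n d e m : ℕ} (hn : 1 ≤ n) (hd : 1 ≤ d)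
    (hbig : ((2*(n : ℚ) + 2) / (2*(n : ℚ) + 3)) * ((d : ℚ) - 1) + 2*(n : ℚ) + 1 ≤ (e : ℚ))
    (hm : e ≤ n * m + 1) : d + 1 ≤ e + m := by
  have hn' : (1 : ℚ) ≤ n := by exact_mod_cast hn
  have hd' : (1 : ℚ) ≤ d := by exact_mod_cast hd
  have hm' : (e : ℚ) ≤ n * m + 1 := by exact_mod_cast hm
  have hpos : (0 : ℚ) < 2 * n + 3 := by linarith
  have h1 : (2 * (n : ℚ) + 2) * (d - 1) + (2 * n + 1) * (2 * n + 3) ≤ (2 * n + 3) * e := by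
    have h := mul_le_mul_of_nonneg_left hbig hpos.le
    have heq : (2 * (n : ℚ) + 3) * (((2*(n : ℚ) + 2) / (2*(n : ℚ) + 3)) * ((d : ℚ) - 1)
        + 2*(n : ℚ) + 1) = (2 * (n : ℚ) + 2) * (d - 1) + (2 * n + 1) * (2 * n + 3) := by
      field_simp
      ring
    linarith
  have key : (d : ℚ) + 1 ≤ e + m := by
    by_contra! hlt
    have h2 : (n : ℚ) * m ≤ n * (d + 1 - e) := mul_le_mul_of_nonneg_left (by linarith) (by linarith)
    have h3 : ((2 * n + 3) * (n + 1) : ℚ) * e ≤ (2 * n + 3) * (n * (d + 1) + 1) := by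
      nlinarith
    have h4 := mul_le_mul_of_nonneg_left h1 (show (0 : ℚ) ≤ n + 1 by linarith)
    nlinarith [mul_nonneg (show (0 : ℚ) ≤ n by linarith) (show (0 : ℚ) ≤ d - 1 by linarith)]
  exact_mod_cast key

end FiniteSchemeRegularity

open FiniteSchemeRegularity

/-- Lemma 5.3. -/
theorem stmt15 (K : Type) [Field K] [IsAlgClosed K] [CharZero K] (n d : ℕ)
    (I : Ideal (MvPolynomial (Fin (n+1)) K))
    (hfin : IsFiniteSubscheme I) (hnd : NondegenerateScheme I)
    (hlgp : InLinGenPos I) (hdeg : schemeDeg I = d)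
    (hd : 4*n^2 + 6*n + 1 ≤ d)
    (C : Ideal (MvPolynomial (Fin (n+1)) K)) (hC : IsRNC n C)
    (hbig : ((2*(n : ℚ) + 2) / (2*(n : ℚ) + 3)) * ((d : ℚ) - 1) + 2*(n : ℚ) + 1
        ≤ (schemeDeg (interIdeal I C) : ℚ)) :
    schemeReg (interIdeal I C) = schemeReg I := by
  have hd1 : 1 ≤ d := le_trans (Nat.le_add_left _ _) hd
  have key : ∀ m, hilbF (interIdeal I C) m = schemeDeg (interIdeal I C) ↔
      hilbF I m = schemeDeg I := by
    obtain rfl | hn := Nat.eq_zero_or_pos n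
    · have hI : schemeDeg I ≠ 0 := by omega
      have hJ : schemeDeg (interIdeal I C) ≠ 0 := fun h => by
        have hd' : (1 : ℚ) ≤ d := by exact_mod_cast hd1
        rw [h] at hbig
        norm_num at hbig
        linarith
      have hone : ∀ {J : Ideal (MvPolynomial (Fin (0+1)) K)}, schemeDeg J ≠ 0 → ∀ m,
          hilbF J m = schemeDeg J := fun hJ m => by
        obtain ⟨k, hk⟩ := (eventually_hilbF_eq_schemeDeg hJ).exists
        rw [hilbF_eq_one_of_schemeDeg_ne_zero hJ] at hk ⊢
        exact hk
      exact fun m => iff_of_true (hone hJ m) (hone hI m)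
    · obtain ⟨p, hp, hspan, rfl⟩ := hC
      have hmem : ∀ m, ∀ F ∈ homogeneousSubmodule (Fin (n+1)) K m,
          (F ∈ ⨅ x : Fin 2 → K, RingHom.ker (eval (fun i => eval x (p i)) :
            MvPolynomial (Fin (n+1)) K →+* K)) ↔ dehomogenizedParam p F = 0 := fun m F hF => by
        rw [mem_iInf_ker_eval_iff, dehomogenizedParam, AlgHom.comp_apply,
          aeval_X_one_eq_zero_iff (IsHomogeneous.aeval hF p hp)]
      have hdegle : ∀ m, ∀ F ∈ homogeneousSubmodule (Fin (n+1)) K m,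
          (dehomogenizedParam p F).natDegree ≤ n * m := fun m F hF =>
        natDegree_aeval_X_one_le (IsHomogeneous.aeval hF p hp)
      exact hilbF_interIdeal_eq_schemeDeg_iff hfin (isHomogeneous_iInf_ker_eval hn hp)
        (homogeneousSubmodule_inf_le_mul_of_parametrization hmem hdegle
          (exists_dehomogenizedParam_eq hspan))
        (hilbF_le_of_parametrization hmem hdegle)
        fun m hm => schemeDeg_add_one_le hn (hdeg ▸ hd1) (hdeg ▸ hbig) hm
  simp only [schemeReg, key]
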